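/- arXiv:2410.08031 — 4 statements merged into one kernel-verified Lean document; each statement's English description precedes it below -/
import Mathlib

section
/- Let A be a symmetric real n×n matrix, let ε ≥ 0, and let x be a point of the standard simplex Δ^{n−1}. Then the strategy profile (x, x) is an ε-well-supported Nash equilibrium of the common-payoff bimatrix game (A, A) if and only if x is an ε-KKT point of the quadratic program min_{x ∈ Δ^{n−1}} −xᵀAx; that is, if and only if there exists u ∈ ℝ such that for every i ∈ [n]: −2(Ax)_i ≥ u − ε whenever x_i = 0, and −2(Ax)_i ∈ [u − ε, u + ε] whenever x_i > 0. -/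
/-- For a symmetric real n×n matrix `A`, `ε ≥ 0`, and `x` in the standard
simplex, `(x, x)` is an ε-well-supported Nash equilibrium of the common-payoff bimatrix
game `(A, A)` iff `x` is an ε-KKT point of `min −xᵀAx` over the simplex. -/
theorem symmetric_common_payoff_wsne_iff_kkt
    {n : ℕ} (A : Matrix (Fin n) (Fin n) ℝ) (hA : A.IsSymm)
    (ε : ℝ) (hε : 0 ≤ ε) (x : Fin n → ℝ) (hx : x ∈ stdSimplex ℝ (Fin n)) :
    ((∀ i, 0 < x i → ∀ j, A.mulVec x i ≥ A.mulVec x j - ε) ∧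
      (∀ i, 0 < x i → ∀ j, Matrix.vecMul x A i ≥ Matrix.vecMul x A j - ε))
    ↔ (∃ u : ℝ, ∀ i,
        (x i = 0 → -2 * A.mulVec x i ≥ u - ε) ∧
        (0 < x i → -2 * A.mulVec x i ∈ Set.Icc (u - ε) (u + ε))) := by
  have hvec : Matrix.vecMul x A = A.mulVec x := by
    rw [← Matrix.mulVec_transpose, hA.eq]
  rw [hvec, and_self_iff]
  constructor
  · intro h
    obtain ⟨k, -, -⟩ : ∃ k ∈ Finset.univ, x k ≠ 0 :=
      Finset.exists_ne_zero_of_sum_ne_zero (by rw [hx.2]; exact one_ne_zero)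
    have : Nonempty (Fin n) := ⟨k⟩
    obtain ⟨m, hm⟩ := Finite.exists_max (A.mulVec x)
    refine ⟨-2 * A.mulVec x m + ε, fun i => ⟨fun _ => ?_, fun hi => ⟨?_, ?_⟩⟩⟩
    · linarith [hm i]
    · linarith [hm i]
    · linarith [h i hi m]
  · rintro ⟨u, hu⟩ i hi j
    have hj : u - ε ≤ -2 * A.mulVec x j := by
      rcases (hx.1 j).eq_or_lt with h0 | hpos
      · exact (hu j).1 h0.symm
      · exact ((hu j).2 hpos).1
    linarith [((hu i).2 hi).2]
end

section
/- Let A be a real n×n matrix, ε ≥ 0, and y ∈ Δ^{n−1} such that (y, y) is a symmetric ε-well-supported Nash equilibrium of the symmetric bimatrix game (A, Aᵀ). Let S = {i ∈ [n] : y_i > 0} and let x ∈ Δ^{n−1} be the uniform distribution on S (x_i = 1/|S| for i ∈ S and x_i = 0 otherwise). Then (x, y) is an ε-well-supported Nash equilibrium of the imitation game (A, I), where I is the n×n identity matrix. -/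
/-- If `(y, y)` is a symmetric ε-well-supported NE of the symmetric game
`(A, A.transpose)` and `x` is the uniform distribution on the support `S` of `y`, then `(x, y)`
is an ε-well-supported NE of the imitation game `(A, I)`. -/
theorem imitation_wsne_of_symmetric_wsne
    {n : ℕ} (A : Matrix (Fin n) (Fin n) ℝ)
    (ε : ℝ) (hε : 0 ≤ ε) (y : Fin n → ℝ) (hy : y ∈ stdSimplex ℝ (Fin n))
    (hwsne₁ : ∀ i, 0 < y i → ∀ j, A.mulVec y i ≥ A.mulVec y j - ε)
    (hwsne₂ : ∀ i, 0 < y i → ∀ j, Matrix.vecMul y A.transpose i ≥ Matrix.vecMul y A.transpose j - ε)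
    (x : Fin n → ℝ)
    (hxdef : ∀ i, x i =
      if 0 < y i then (1 : ℝ) / (Finset.univ.filter fun j => 0 < y j).card else 0) :
    x ∈ stdSimplex ℝ (Fin n) ∧
    (∀ i, 0 < x i → ∀ j, A.mulVec y i ≥ A.mulVec y j - ε) ∧
    (∀ i, 0 < y i → ∀ j,
      Matrix.vecMul x (1 : Matrix (Fin n) (Fin n) ℝ) i ≥
        Matrix.vecMul x (1 : Matrix (Fin n) (Fin n) ℝ) j - ε) := by
  have hne : (Finset.univ.filter fun j => 0 < y j).Nonempty := by
    by_contra h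
    have hnonpos : ∑ i, y i ≤ 0 :=
      Finset.sum_nonpos fun i _ => not_lt.1 fun hi => h ⟨i, by simpa using hi⟩
    linarith [hy.2]
  have hcard : (0 : ℝ) < (Finset.univ.filter fun j => 0 < y j).card := by
    exact_mod_cast hne.card_pos
  refine ⟨⟨fun i => ?_, ?_⟩, fun i hi => hwsne₁ i ?_, fun i hi j => ?_⟩
  · rw [hxdef]
    split_ifs <;> positivity
  · simp_rw [hxdef]
    rw [← Finset.sum_filter, Finset.sum_const, nsmul_eq_mul, mul_one_div_cancel hcard.ne']
  · by_contra h
    simp [hxdef, h] at hi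
  · rw [Matrix.vecMul_one, hxdef i, hxdef j, if_pos hi]
    have hpos := one_div_pos.2 hcard
    split_ifs <;> linarith
end

section
/- Let A be a real n×n matrix and let 0 ≤ ε < 1/n. Then for every y ∈ Δ^{n−1}, the following are equivalent: (1) (y, y) is a symmetric ε-well-supported Nash equilibrium of the symmetric bimatrix game (A, Aᵀ); (2) there exists x ∈ Δ^{n−1} such that (x, y) is an ε-well-supported Nash equilibrium of the imitation game (A, I), where I is the n×n identity matrix. -/
/-- Some coordinate of a point of the standard simplex is at least the average `1 / n`. -/
theorem exists_one_div_le_of_mem_stdSimplex {n : ℕ} (hn : 0 < n) {x : Fin n → ℝ}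
    (hx : x ∈ stdSimplex ℝ (Fin n)) : ∃ j, 1 / (n : ℝ) ≤ x j := by
  have hn' : (n : ℝ) ≠ 0 := by positivity
  obtain ⟨j, -, hj⟩ := Finset.exists_le_of_sum_le (s := Finset.univ)
    (f := fun _ : Fin n => 1 / (n : ℝ)) (g := x) ⟨⟨0, hn⟩, Finset.mem_univ _⟩
    (by simp [hx.2, hn'])
  exact ⟨j, hj⟩


/-- For `0 ≤ ε < 1/n` and `y` in the standard simplex, `(y, y)` is a symmetric
ε-well-supported NE of the symmetric game `(A, Aᵀ)` iff there is `x` in the simplex such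
that `(x, y)` is an ε-well-supported NE of the imitation game `(A, I)`. -/
theorem symmetric_wsne_iff_imitation_wsne
    {n : ℕ} (A : Matrix (Fin n) (Fin n) ℝ)
    (ε : ℝ) (hε : 0 ≤ ε) (hεn : ε < 1 / n)
    (y : Fin n → ℝ) (hy : y ∈ stdSimplex ℝ (Fin n)) :
    ((∀ i, 0 < y i → ∀ j, A.mulVec y i ≥ A.mulVec y j - ε) ∧
      (∀ i, 0 < y i → ∀ j, Matrix.vecMul y A.transpose i ≥ Matrix.vecMul y A.transpose j - ε))
    ↔ (∃ x ∈ stdSimplex ℝ (Fin n),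
        (∀ i, 0 < x i → ∀ j, A.mulVec y i ≥ A.mulVec y j - ε) ∧
        (∀ i, 0 < y i → ∀ j,
          Matrix.vecMul x (1 : Matrix (Fin n) (Fin n) ℝ) i ≥
            Matrix.vecMul x (1 : Matrix (Fin n) (Fin n) ℝ) j - ε)) := by
  simp only [Matrix.vecMul_transpose, Matrix.vecMul_one, and_self]
  constructor
  · intro h
    classical
    set S : Finset (Fin n) := Finset.univ.filter fun i => 0 < y i with hS
    have hne : S.Nonempty := by
      obtain ⟨i, -, hi⟩ := Finset.exists_ne_zero_of_sum_ne_zero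
        (s := Finset.univ) (f := y) (by rw [hy.2]; exact one_ne_zero)
      exact ⟨i, by simpa [hS] using lt_of_le_of_ne (hy.1 i) hi.symm⟩
    have hcard : (0 : ℝ) < S.card := by exact_mod_cast hne.card_pos
    refine ⟨fun i => if 0 < y i then (S.card : ℝ)⁻¹ else 0, ⟨fun i => ?_, ?_⟩,
      fun i hi => ?_, fun i hi j => ?_⟩
    · dsimp only
      split_ifs <;> positivity
    · rw [← Finset.sum_filter, ← hS, Finset.sum_const, nsmul_eq_mul,
        mul_inv_cancel₀ hcard.ne']
    · by_cases hyi : 0 < y i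
      · exact h i hyi
      · simp [hyi] at hi
    · have hinv : (0 : ℝ) < (S.card : ℝ)⁻¹ := by positivity
      simp only [hi, if_true]
      split_ifs <;> linarith
  · rintro ⟨x, hx, hxA, hxy⟩ i hi
    obtain ⟨j, hj⟩ := exists_one_div_le_of_mem_stdSimplex i.pos hx
    exact hxA i (by linarith [hxy i hi j])
end

section
/- Let A = (a_{ij}) be a symmetric real n×n matrix, b ∈ ℝⁿ, ε > 0, M = max(1, max_i(|b_i| + Σ_j |a_{ij}|)), and δ = ε/(4 + 4nM). Suppose x, y ∈ ℝⁿ with x_i, y_i ≥ 0 for all i, z ≥ 0 with Σ_i x_i + Σ_i y_i + z = 2n, and u ∈ ℝ satisfy: 0 ≥ u − δ if z = 0 and 0 ∈ [u − δ, u + δ] if z > 0; for each i, (M/δ)(x_i + y_i − 1) ≥ u − δ if y_i = 0 and (M/δ)(x_i + y_i − 1) ∈ [u − δ, u + δ] if y_i > 0; and for each i, Σ_j a_{ij} x_j + b_i + (M/δ)(x_i + y_i − 1) ≥ u − δ if x_i = 0 and Σ_j a_{ij} x_j + b_i + (M/δ)(x_i + y_i − 1) ∈ [u − δ, u + δ]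 if x_i > 0. Define x' ∈ ℝⁿ by x'_i = min(1, x_i). Then x' is an ε-KKT point of the box-constrained quadratic program min ½xᵀAx + bᵀx subject to 0 ≤ x_i ≤ 1 for all i; in fact, for each i ∈ [n]: Σ_j a_{ij} x'_j + b_i ≥ −4δ(1+M) if x'_i = 0, Σ_j a_{ij} x'_j + b_i ∈ [−4δ(1+M), 4δ(1+M)] if 0 < x'_i < 1, and Σ_j a_{ij} x'_j + b_i ≤ 4δ(1+M) if x'_i = 1, where 4δ(1+M) ≤ ε. -/
/-- Hölder's inequality for a finite sum, with a pointwise bound on the second factor. -/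
lemma abs_sum_mul_le_mul_sum_abs {ι : Type*} (s : Finset ι) (a w : ι → ℝ) {c : ℝ}
    (hw : ∀ j ∈ s, |w j| ≤ c) : |∑ j ∈ s, a j * w j| ≤ c * ∑ j ∈ s, |a j| := by
  rw [Finset.mul_sum]
  refine (Finset.abs_sum_le_sum_abs _ _).trans (Finset.sum_le_sum fun j hj => ?_)
  rw [abs_mul, mul_comm]
  exact mul_le_mul_of_nonneg_right (hw j hj) (abs_nonneg _)

/-- An affine form whose coefficients have total absolute value at most `M` is bounded by `M * c`
on the cube of radius `c ≥ 1`. -/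
lemma abs_sum_mul_add_le {ι : Type*} (s : Finset ι) (a w : ι → ℝ) {β c M : ℝ}
    (hM : |β| + ∑ j ∈ s, |a j| ≤ M) (hc : 1 ≤ c) (hw : ∀ j ∈ s, |w j| ≤ c) :
    |(∑ j ∈ s, a j * w j) + β| ≤ M * c := by
  have h1 := abs_sum_mul_le_mul_sum_abs s a w hw
  have h2 := abs_add_le (∑ j ∈ s, a j * w j) β
  nlinarith [abs_nonneg β]

/-- Under the δ-approximate KKT conditions of the auxiliary
simplex-constrained QP, the truncated point `x' = min(1, x)` is an ε-KKT point of the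
box-constrained QP `min ½xᵀAx + bᵀx` over `[0,1]ⁿ`; in fact it satisfies the stronger
`4δ(1+M)`-KKT conditions, and `4δ(1+M) ≤ ε`. -/
theorem aux_qp_kkt_truncation_box_kkt
    {n : ℕ} (hn : 0 < n) (A : Matrix (Fin n) (Fin n) ℝ) (hA : A.IsSymm)
    (b : Fin n → ℝ) (ε : ℝ) (hε : 0 < ε) (M δ : ℝ)
    (hM : M = max 1 (Finset.univ.sup' ⟨⟨0, hn⟩, Finset.mem_univ _⟩
      fun i => |b i| + ∑ j, |A i j|))
    (hδ : δ = ε / (4 + 4 * n * M))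
    (x y : Fin n → ℝ) (z u : ℝ)
    (hxnn : ∀ i, 0 ≤ x i) (hynn : ∀ i, 0 ≤ y i) (hznn : 0 ≤ z)
    (hsum : (∑ i, x i) + (∑ i, y i) + z = 2 * n)
    (hz0 : z = 0 → 0 ≥ u - δ)
    (hz1 : 0 < z → (0 : ℝ) ∈ Set.Icc (u - δ) (u + δ))
    (hy0 : ∀ i, y i = 0 → M / δ * (x i + y i - 1) ≥ u - δ)
    (hy1 : ∀ i, 0 < y i → M / δ * (x i + y i - 1) ∈ Set.Icc (u - δ) (u + δ))
    (hx0 : ∀ i, x i = 0 →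
      (∑ j, A i j * x j) + b i + M / δ * (x i + y i - 1) ≥ u - δ)
    (hx1 : ∀ i, 0 < x i →
      (∑ j, A i j * x j) + b i + M / δ * (x i + y i - 1) ∈ Set.Icc (u - δ) (u + δ)) :
    (∀ i, (min 1 (x i) = 0 → (∑ j, A i j * min 1 (x j)) + b i ≥ -ε) ∧
      (0 < min 1 (x i) → min 1 (x i) < 1 →
        (∑ j, A i j * min 1 (x j)) + b i ∈ Set.Icc (-ε) ε) ∧
      (min 1 (x i) = 1 → (∑ j, A i j * min 1 (x j)) + b i ≤ ε)) ∧
    4 * δ * (1 + M) ≤ ε ∧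
    (∀ i, (min 1 (x i) = 0 →
        (∑ j, A i j * min 1 (x j)) + b i ≥ -(4 * δ * (1 + M))) ∧
      (0 < min 1 (x i) → min 1 (x i) < 1 →
        (∑ j, A i j * min 1 (x j)) + b i ∈
          Set.Icc (-(4 * δ * (1 + M))) (4 * δ * (1 + M))) ∧
      (min 1 (x i) = 1 →
        (∑ j, A i j * min 1 (x j)) + b i ≤ 4 * δ * (1 + M))) := by
  have hn1 : (1 : ℝ) ≤ n := by exact_mod_cast hn
  have hM1 : 1 ≤ M := hM ▸ le_max_left _ _
  have hrow (i : Fin n) : |b i| + ∑ j, |A i j| ≤ M := by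
    rw [hM]
    exact le_max_of_le_right
      (Finset.le_sup' (fun i => |b i| + ∑ j, |A i j|) (Finset.mem_univ i))
  have hnM : M ≤ n * M := le_mul_of_one_le_left (by linarith) hn1
  have hden : 0 < 4 + 4 * n * M := by linarith
  have hδ0 : 0 < δ := hδ ▸ div_pos hε hden
  have hδε : δ * (4 + 4 * n * M) = ε := by rw [hδ]; field_simp
  have hle : 4 * δ * (1 + M) ≤ ε := by nlinarith
  have habs (j : Fin n) : |min 1 (x j)| ≤ 1 := by
    rw [abs_of_nonneg (le_min zero_le_one (hxnn j))]
    exact min_le_left _ _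
  have htrunc (i : Fin n) : |(∑ j, A i j * min 1 (x j)) + b i| ≤ M := by
    simpa using abs_sum_mul_add_le Finset.univ (A i) _ (hrow i) le_rfl fun j _ => habs j
  suffices key : ∀ i, (min 1 (x i) = 0 →
        (∑ j, A i j * min 1 (x j)) + b i ≥ -(4 * δ * (1 + M))) ∧
      (0 < min 1 (x i) → min 1 (x i) < 1 →
        (∑ j, A i j * min 1 (x j)) + b i ∈
          Set.Icc (-(4 * δ * (1 + M))) (4 * δ * (1 + M))) ∧
      (min 1 (x i) = 1 →
        (∑ j, A i j * min 1 (x j)) + b i ≤ 4 * δ * (1 + M)) by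
    refine ⟨fun i => ?_, hle, key⟩
    obtain ⟨h0, h1, h2⟩ := key i
    refine ⟨fun h => ?_, fun h h' => ?_, fun h => (h2 h).trans hle⟩
    · linarith [h0 h]
    · exact ⟨by linarith [(h1 h h').1], by linarith [(h1 h h').2]⟩
  -- If `δ` is large, the claim is just boundedness of the gradient on the box.
  rcases le_or_gt M (4 * δ * (1 + M)) with hbig | hsmall
  · intro i
    have h := abs_le.1 (htrunc i)
    exact ⟨fun _ => by linarith, fun _ _ => ⟨by linarith, by linarith⟩, fun _ => by linarith⟩
  have hδ4 : δ < 1 / 4 := by nlinarith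
  set K := M / δ with hK
  have hKδ : K * δ = M := div_mul_cancel₀ _ hδ0.ne'
  have hK4 : 4 * M < K := by
    rw [hK, lt_div_iff₀ hδ0]
    nlinarith
  have hu : u ≤ δ := by
    rcases hznn.eq_or_lt with h | h
    · linarith [hz0 h.symm]
    · linarith [(hz1 h).1]
  have hlow (i : Fin n) : K * (x i + y i - 1) ≥ u - δ := by
    rcases (hynn i).eq_or_lt with h | h
    · exact hy0 i h.symm
    · exact (hy1 i h).1
  obtain ⟨m, -, hmax⟩ := Finset.exists_max_image Finset.univ (fun i => x i + y i)
    ⟨⟨0, hn⟩, Finset.mem_univ _⟩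
  have hxm (j : Fin n) : x j ≤ x m + y m := by
    linarith [hmax j (Finset.mem_univ j), hynn j]
  -- The quadratic penalty keeps the largest of the sums `x i + y i` close to `1`.
  have hover : x m + y m ≤ 1 + 2 * δ := by
    by_contra! hs
    rcases (hynn m).eq_or_lt with h | h
    · have hgrad := abs_le.1 <| abs_sum_mul_add_le Finset.univ (A m) x (c := x m + y m)
        (hrow m) (by linarith) fun j _ => by
          rw [abs_of_nonneg (hxnn j)]
          exact hxm j
      have h1 := (hx1 m (by linarith)).2
      nlinarith [mul_pos (show 0 < K - M by linarith) (sub_pos.2 hs)]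
    · have h1 := (hy1 m h).2
      nlinarith [mul_pos (show 0 < K by linarith) (sub_pos.2 hs)]
  have hz : 0 < z := by
    refine hznn.lt_of_ne fun h => ?_
    have h1 : ∑ i, (x i + y i) ≤ ∑ _i : Fin n, (1 + 2 * δ) :=
      Finset.sum_le_sum fun i hi => (hmax i hi).trans hover
    rw [Finset.sum_add_distrib] at h1
    simp only [Finset.sum_const, Finset.card_univ, Fintype.card_fin, nsmul_eq_mul] at h1
    nlinarith
  have hu' : -δ ≤ u := by linarith [(hz1 hz).2]
  have hdiff (i : Fin n) :
      |(∑ j, A i j * min 1 (x j)) - ∑ j, A i j * x j| ≤ 2 * δ * M := by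
    rw [← Finset.sum_sub_distrib]
    simp only [← mul_sub]
    refine (abs_sum_mul_le_mul_sum_abs _ (A i) _ (c := 2 * δ) fun j _ => ?_).trans ?_
    · rw [abs_le]
      rcases le_total 1 (x j) with h | h
      · rw [min_eq_left h]
        exact ⟨by linarith [hxm j], by linarith⟩
      · rw [min_eq_right h]
        exact ⟨by linarith, by linarith⟩
    · exact mul_le_mul_of_nonneg_left (by linarith [hrow i, abs_nonneg (b i)]) (by linarith)
  have hδM : 0 < δ * M := by positivity
  have hupper (i : Fin n) (hi : 0 < x i) :
      (∑ j, A i j * min 1 (x j)) + b i ≤ 4 * δ * (1 + M) := by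
    linarith [(hx1 i hi).2, hlow i, (abs_le.1 (hdiff i)).2]
  have hlower (i : Fin n) (hi : x i < 1) :
      (∑ j, A i j * min 1 (x j)) + b i ≥ -(4 * δ * (1 + M)) := by
    have hg : (∑ j, A i j * x j) + b i + K * (x i + y i - 1) ≥ u - δ := by
      rcases (hxnn i).eq_or_lt with h | h
      · exact hx0 i h.symm
      · exact (hx1 i h).1
    have hp : K * (x i + y i - 1) ≤ 2 * δ := by
      rcases (hynn i).eq_or_lt with h | h
      · have : K * (x i + y i - 1) ≤ 0 :=
          mul_nonpos_of_nonneg_of_nonpos (by linarith) (by linarith)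
        linarith
      · linarith [(hy1 i h).2]
    linarith [(abs_le.1 (hdiff i)).1]
  refine fun i => ⟨fun h => hlower i ?_, fun h h' => ?_, fun h => hupper i ?_⟩
  · by_contra! hi
    rw [min_eq_left hi] at h
    exact one_ne_zero h
  · have hi : x i < 1 := by
      by_contra! hi
      rw [min_eq_left hi] at h'
      exact lt_irrefl _ h'
    exact ⟨hlower i hi, hupper i (h.trans_le (min_le_right _ _))⟩
  · linarith [min_le_right 1 (x i)]
end
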